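/- arXiv:1008.4164 — 2 statements merged into one kernel-verified Lean document; each statement's English description precedes it below -/
import Mathlib

section
/- Let M be a comultiplication module over a ring R in which every prime ideal is maximal. Then every second submodule of M is simple, i.e. Spec^s(M) = S(M). -/
section Prelim

variable {R : Type*} [Ring R] {M : Type*} [AddCommGroup M] [Module R M]

/-- A left ideal of `R` is two-sided. -/
def IsTwoSidedIdeal (I : Ideal R) : Prop := ∀ r ∈ I, ∀ s : R, r * s ∈ I

/-- `M` is a coprime module: `IM = M` or `IM = 0` for every two-sided ideal `I`. -/
def IsCoprimeModule (R M : Type*) [Ring R] [AddCommGroup M] [Module R M] : Prop :=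
  ∀ I : Ideal R, IsTwoSidedIdeal I →
    I • (⊤ : Submodule R M) = ⊤ ∨ I • (⊤ : Submodule R M) = ⊥

/-- A proper submodule `K ⊊ M` is a coprime submodule of `M`:
`IM + K = M` or `IM ⊆ K` for every two-sided ideal `I`. -/
def IsCoprimeSubmodule (K : Submodule R M) : Prop :=
  K ≠ ⊤ ∧ ∀ I : Ideal R, IsTwoSidedIdeal I →
    I • (⊤ : Submodule R M) ⊔ K = ⊤ ∨ I • (⊤ : Submodule R M) ≤ K

/-- A nonzero submodule `K ≤ M` is second: `IK = K` or `IK = 0`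
for every two-sided ideal `I`. -/
def IsSecondSubmodule (K : Submodule R M) : Prop :=
  K ≠ ⊥ ∧ ∀ I : Ideal R, IsTwoSidedIdeal I → I • K = K ∨ I • K = ⊥

/-- The ideal `(K :_R M) = {r | r • M ⊆ K}`. -/
def colonIdeal (K : Submodule R M) : Ideal R where
  carrier := {r : R | ∀ m : M, r • m ∈ K}
  zero_mem' := by intro m; rw [zero_smul]; exact K.zero_mem
  add_mem' := by intro a b ha hb m; rw [add_smul]; exact K.add_mem (ha m) (hb m)
  smul_mem' := by intro s r hr m; rw [smul_eq_mul, mul_smul]; exact K.smul_mem s (hr m)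

/-- The annihilator `(0 :_M I)` of a two-sided ideal `I` in `M`. -/
def annSubmodule (I : Ideal R) (hI : IsTwoSidedIdeal I) : Submodule R M where
  carrier := {m : M | ∀ r ∈ I, r • m = 0}
  zero_mem' := by intro r _; exact smul_zero r
  add_mem' := by intro a b ha hb r hr; rw [smul_add, ha r hr, hb r hr, add_zero]
  smul_mem' := by intro s m hm r hr; rw [← mul_smul]; exact hm _ (hI r hr s)

/-- A nonzero submodule `K` is strongly hollow in `M`. -/
def StronglyHollowIn (K : Submodule R M) : Prop :=
  K ≠ ⊥ ∧ ∀ L₁ L₂ : Submodule R M, K ≤ L₁ ⊔ L₂ → K ≤ L₁ ∨ K ≤ L₂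

/-- A proper submodule `K` is strongly irreducible in `M`. -/
def StronglyIrreducibleIn (K : Submodule R M) : Prop :=
  K ≠ ⊤ ∧ ∀ L₁ L₂ : Submodule R M, L₁ ⊓ L₂ ≤ K → L₁ ≤ K ∨ L₂ ≤ K

/-- `V^s(L)`: the second submodules of `M` contained in `L`. -/
def secondVariety (L : Submodule R M) : Set (Submodule R M) :=
  {K | IsSecondSubmodule K ∧ K ≤ L}

/-- `V^c(L)`: the coprime submodules of `M` containing `L`. -/
def coprimeVariety (L : Submodule R M) : Set (Submodule R M) :=
  {K | IsCoprimeSubmodule K ∧ L ≤ K}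

lemma IsTwoSidedIdeal.inf {I J : Ideal R} (hI : IsTwoSidedIdeal I)
    (hJ : IsTwoSidedIdeal J) : IsTwoSidedIdeal (I ⊓ J) := by
  intro r hr s
  rw [Submodule.mem_inf] at hr ⊢
  exact ⟨hI r hr.1 s, hJ r hr.2 s⟩

lemma IsTwoSidedIdeal.mul {I J : Ideal R} (hJ : IsTwoSidedIdeal J) :
    IsTwoSidedIdeal (I * J) := by
  intro r hr s
  refine Submodule.smul_induction_on hr ?_ ?_
  · intro a ha b hb
    rw [smul_eq_mul, mul_assoc]
    exact Ideal.mul_mem_mul ha (hJ b hb s)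
  · intro x y hx hy
    rw [add_mul]
    exact Ideal.add_mem _ hx hy

end Prelim

/-- Let `M` be a comultiplication module over a ring in which every
prime (two-sided) ideal is maximal (among proper two-sided ideals). Then the second
submodules of `M` are exactly the simple submodules. -/
theorem statement7 {R M : Type*} [Ring R] [AddCommGroup M] [Module R M]
    (hcomul : ∀ L : Submodule R M,
      (L : Set M) = {m : M | ∀ r : R, (∀ x ∈ L, r • x = 0) → r • m = 0})
    (hzd : ∀ p : Ideal R, IsTwoSidedIdeal p → p ≠ ⊤ →
      (∀ I J : Ideal R, IsTwoSidedIdeal I → IsTwoSidedIdeal J →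
        (∀ a ∈ I, ∀ b ∈ J, a * b ∈ p) → I ≤ p ∨ J ≤ p) →
      ∀ q : Ideal R, IsTwoSidedIdeal q → p ≤ q → q ≠ ⊤ → q = p) :
    ∀ K : Submodule R M, IsSecondSubmodule K ↔
      (K ≠ ⊥ ∧ ∀ L : Submodule R M, L ≤ K → L = ⊥ ∨ L = K) := by
  intro K
  constructor
  · rintro ⟨hK, h2⟩
    refine ⟨hK, fun L hL => ?_⟩
    by_cases hL0 : L = ⊥
    · exact Or.inl hL0
    right
    have hts : ∀ N : Submodule R M, IsTwoSidedIdeal (Module.annihilator R N) := by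
      intro N r hr s
      rw [Submodule.mem_annihilator] at hr ⊢
      intro n hn
      rw [mul_smul]
      exact hr _ (N.smul_mem s hn)
    have htop : ∀ N : Submodule R M, N ≠ ⊥ → Module.annihilator R N ≠ ⊤ := by
      intro N hN h
      apply hN
      rw [Submodule.eq_bot_iff]
      intro x hx
      have h1 : (1 : R) ∈ Module.annihilator R N := by rw [h]; trivial
      rw [Submodule.mem_annihilator] at h1
      simpa using h1 x hx
    have key := hzd (Module.annihilator R K) (hts K) (htop K hK) (by
      intro I J hI hJ hIJ
      rcases h2 J hJ with h | h
      · left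
        intro a ha
        rw [Submodule.mem_annihilator]
        intro n hn
        rw [← h] at hn
        refine Submodule.smul_induction_on hn ?_ ?_
        · intro b hb m hm
          rw [← mul_smul]
          exact Submodule.mem_annihilator.1 (hIJ a ha b hb) m hm
        · intro x y hx hy
          rw [smul_add, hx, hy, add_zero]
      · right
        intro b hb
        rw [Submodule.mem_annihilator]
        intro n hn
        have : b • n ∈ J • K := Submodule.smul_mem_smul hb hn
        rw [h] at this
        simpa using this) (Module.annihilator R L) (hts L) (by
        intro r hr
        rw [Submodule.mem_annihilator] at hr ⊢
        exact fun n hn => hr n (hL hn)) (htop L hL0)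
    refine le_antisymm hL ?_
    intro m hm
    have : m ∈ (L : Set M) := by
      rw [hcomul L]
      intro r hr
      have h1 : r ∈ Module.annihilator R L := Submodule.mem_annihilator.2 hr
      rw [key] at h1
      exact Submodule.mem_annihilator.1 h1 m hm
    exact this
  · rintro ⟨hK, h⟩
    refine ⟨hK, fun I _ => (h _ Submodule.smul_le_right).symm⟩
end

section
/- Let G = ⨁_{p prime} ℤ/pℤ as a ℤ-module. Then the coprime submodules of G are exactly the submodules qG for q prime, and the intersection of all coprime submodules of G is 0. -/
open DirectSum in
lemma aux_mem (q : Nat.Primes) (x : ⨁ p : Nat.Primes, ZMod p) :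
    x ∈ Ideal.span {((q : ℕ) : ℤ)} • (⊤ : Submodule ℤ (⨁ p : Nat.Primes, ZMod p)) ↔ x q = 0 := by
  classical
  constructor
  · intro h
    rw [Submodule.ideal_span_singleton_smul, Submodule.mem_smul_pointwise_iff_exists] at h
    obtain ⟨y, -, rfl⟩ := h
    rw [DirectSum.smul_apply]
    simp
  · intro h
    rw [← DirectSum.sum_support_of x]
    refine Submodule.sum_mem _ fun p _ => ?_
    by_cases hp : p = q
    · subst hp
      rw [h, map_zero]
      exact Submodule.zero_mem _
    · have : Fact (p : ℕ).Prime := ⟨p.2⟩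
      have hq : ((q : ℕ) : ZMod p) ≠ 0 := by
        intro h0
        rw [ZMod.natCast_eq_zero_iff] at h0
        exact hp (Subtype.ext ((Nat.prime_dvd_prime_iff_eq p.2 q.2).1 h0))
      have : DirectSum.of (fun p : Nat.Primes => ZMod p) p (x p) =
          ((q : ℕ) : ℤ) • DirectSum.of (fun p : Nat.Primes => ZMod p) p
            (((q : ℕ) : ZMod p)⁻¹ * x p) := by
        rw [← map_zsmul, zsmul_eq_mul, Int.cast_natCast, mul_inv_cancel_left₀ hq]
      rw [this]
      exact Submodule.smul_mem_smul (Ideal.mem_span_singleton_self _) trivial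

open DirectSum in
lemma aux_of (K : Submodule ℤ (⨁ p : Nat.Primes, ZMod p)) (x : ⨁ p : Nat.Primes, ZMod p)
    (hx : x ∈ K) (p : Nat.Primes) (hp : x p ≠ 0) (a : ZMod p) :
    DirectSum.of (fun p : Nat.Primes => ZMod p) p a ∈ K := by
  classical
  have : Fact (p : ℕ).Prime := ⟨p.2⟩
  set n : ℕ := ∏ r ∈ (DFinsupp.support x).erase p, (r : ℕ) with hn
  have hnp : ((n : ℕ) : ZMod p) ≠ 0 := by
    rw [hn, Nat.cast_prod, Finset.prod_ne_zero_iff]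
    intro r hr h0
    rw [ZMod.natCast_eq_zero_iff] at h0
    exact (Finset.mem_erase.1 hr).1
      (Subtype.ext ((Nat.prime_dvd_prime_iff_eq p.2 r.2).1 h0)).symm
  obtain ⟨m, hm⟩ := ZMod.intCast_surjective (a * ((n : ZMod p) * x p)⁻¹)
  have : DirectSum.of (fun p : Nat.Primes => ZMod p) p a = (m * (n : ℤ)) • x := by
    refine DFinsupp.ext fun r => ?_
    change _ = ((m * (n : ℤ)) • x) r
    rw [DirectSum.smul_apply]
    by_cases hr : r = p
    · subst hr
      refine (DirectSum.of_eq_same (β := fun p : Nat.Primes => ZMod p) r a).trans ?_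
      rw [zsmul_eq_mul, Int.cast_mul, hm, Int.cast_natCast]
      field_simp
    · refine (DirectSum.of_eq_of_ne (β := fun p : Nat.Primes => ZMod p) p r a hr).trans ?_
      by_cases hxr : x r = 0
      · rw [hxr, smul_zero]
      · have : ((n : ℕ) : ZMod r) = 0 := by
          rw [ZMod.natCast_eq_zero_iff]
          exact Finset.dvd_prod_of_mem (fun r : Nat.Primes => (r : ℕ))
            (Finset.mem_erase.2 ⟨hr, DFinsupp.mem_support_iff.2 hxr⟩)
        rw [zsmul_eq_mul, Int.cast_mul, Int.cast_natCast, this, mul_zero, zero_mul]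
  rw [this]
  exact K.smul_mem _ hx

open DirectSum in
lemma aux_coatom (q : Nat.Primes) (K : Submodule ℤ (⨁ p : Nat.Primes, ZMod p))
    (h : Ideal.span {((q : ℕ) : ℤ)} • (⊤ : Submodule ℤ (⨁ p : Nat.Primes, ZMod p)) ≤ K) :
    K = Ideal.span {((q : ℕ) : ℤ)} • (⊤ : Submodule ℤ (⨁ p : Nat.Primes, ZMod p)) ∨ K = ⊤ := by
  classical
  by_cases hK : ∀ x ∈ K, x q = 0
  · left
    exact le_antisymm (fun x hx => (aux_mem q x).2 (hK x hx)) h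
  · right
    push Not at hK
    obtain ⟨x, hx, hxq⟩ := hK
    rw [eq_top_iff]
    intro y _
    have h1 := aux_of K x hx q hxq (y q)
    have h2 : y - DirectSum.of (fun p : Nat.Primes => ZMod p) q (y q) ∈ K := by
      apply h
      rw [aux_mem, DirectSum.sub_apply, DirectSum.of_eq_same, sub_self]
    simpa using K.add_mem h2 h1

open DirectSum in
lemma aux_coprime (q : Nat.Primes) : IsCoprimeSubmodule
    (Ideal.span {((q : ℕ) : ℤ)} • (⊤ : Submodule ℤ (⨁ p : Nat.Primes, ZMod p))) := by
  classical
  have : Fact (q : ℕ).Prime := ⟨q.2⟩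
  refine ⟨fun h => ?_, fun I _ => ?_⟩
  · have h1 : DirectSum.of (fun p : Nat.Primes => ZMod p) q 1 ∈
      Ideal.span {((q : ℕ) : ℤ)} • (⊤ : Submodule ℤ (⨁ p : Nat.Primes, ZMod p)) := by
      rw [h]; trivial
    rw [aux_mem, DirectSum.of_eq_same] at h1
    exact one_ne_zero h1
  · rcases aux_coatom q _ (le_sup_right (a := I • ⊤)) with h | h
    · right
      exact sup_eq_right.1 h
    · left
      exact h

open DirectSum in
/-- Let `G = ⨁_{p prime} ℤ/pℤ` as a `ℤ`-module. Then the coprime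
submodules of `G` are exactly the submodules `qG` for `q` prime, and the intersection
of all coprime submodules of `G` is `0`. -/
theorem statement19 :
    (∀ K : Submodule ℤ (⨁ p : Nat.Primes, ZMod p), IsCoprimeSubmodule K ↔
      ∃ q : Nat.Primes,
        K = Ideal.span {((q : ℕ) : ℤ)} • (⊤ : Submodule ℤ (⨁ p : Nat.Primes, ZMod p))) ∧
    sInf {K : Submodule ℤ (⨁ p : Nat.Primes, ZMod p) | IsCoprimeSubmodule K} = ⊥ := by
  classical
  refine ⟨fun K => ⟨fun hK => ?_, ?_⟩, ?_⟩
  · obtain ⟨hK, hI⟩ := hK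
    by_contra hne
    push Not at hne
    apply hK
    rw [eq_top_iff]
    intro y _
    rw [← DirectSum.sum_support_of y]
    refine Submodule.sum_mem _ fun p _ => ?_
    have : Fact (p : ℕ).Prime := ⟨p.2⟩
    rcases hI (Ideal.span {((p : ℕ) : ℤ)}) (fun r hr s => Ideal.mul_mem_right s _ hr) with h | h
    · have h1 : DirectSum.of (fun p : Nat.Primes => ZMod p) p 1 ∈
          Ideal.span {((p : ℕ) : ℤ)} • (⊤ : Submodule ℤ (⨁ p : Nat.Primes, ZMod p)) ⊔ K := by
        rw [h]; trivial
      obtain ⟨u, hu, k, hk, huk⟩ := Submodule.mem_sup.1 h1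
      refine aux_of K k hk p ?_ _
      intro hkp
      have h2 := congrArg (fun z : ⨁ p : Nat.Primes, ZMod p => z p) huk
      simp only [DirectSum.add_apply, DirectSum.of_eq_same, (aux_mem p u).1 hu, hkp,
        add_zero] at h2
      exact zero_ne_one h2
    · rcases aux_coatom p K h with h | h
      · exact absurd h (hne p)
      · exact absurd h hK
  · rintro ⟨q, rfl⟩
    exact aux_coprime q
  · rw [eq_bot_iff]
    intro x hx
    rw [Submodule.mem_bot]
    refine DFinsupp.ext fun q => ?_
    exact (aux_mem q x).1 ((Submodule.mem_sInf.1 hx) _ (aux_coprime q))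
end
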